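/- arXiv:2504.17444 — 7 statements merged into one kernel-verified Lean document; each statement's English description precedes it below -/
import Mathlib

section
/- (Encoding Relational Triples) For every relation RL on ΣL and all program-as-resource assertions 𝒫, 𝒬: the relational Hoare triple ⟨𝒫⟩ RL ⟨𝒬⟩ is valid if and only if for every X ⊆ ΣH the standard Hoare triple ⊢∀ {⦇𝒫⦈_X} RL {⦇𝒬⦈_X} is valid. -/
/-- Weakest liberal precondition of a relation `R` for postcondition `X`. -/
def wlp {S : Type*} (R : S → S → Prop) (X : Set S) : Set S :=
  {σ | ∀ σ', R σ σ' → σ' ∈ X}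

/-- Configuration refinement: `(σ₁, R₁) ↪ (σ₂, R₂)`. -/
def ConfigRefines {S : Type*} (σ₁ : S) (R₁ : S → S → Prop)
    (σ₂ : S) (R₂ : S → S → Prop) : Prop :=
  ∀ σ₃, R₂ σ₂ σ₃ → R₁ σ₁ σ₃

/-- Validity of the relational Hoare triple `⟨𝒫⟩ RL ⟨𝒬⟩`. -/
def RelTriple {SL SH : Type*}
    (P : Set (SL × SH × (SH → SH → Prop))) (RL : SL → SL → Prop)
    (Q : Set (SL × SH × (SH → SH → Prop))) : Prop :=
  ∀ σL₁ σH₁ R₁, (σL₁, σH₁, R₁) ∈ P → ∀ σL₂, RL σL₁ σL₂ →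
    ∃ σH₂ R₂, ConfigRefines σH₁ R₁ σH₂ R₂ ∧ (σL₂, σH₂, R₂) ∈ Q

/-- Validity of the standard Hoare triple `⊢∀ {P} R {Q}`. -/
def HoareForall {S : Type*} (P : Set S) (R : S → S → Prop) (Q : Set S) : Prop :=
  ∀ σ₁ ∈ P, ∀ σ₂, R σ₁ σ₂ → σ₂ ∈ Q

/-- The encoding `⦇𝒫⦈_X` of a program-as-resource assertion. -/
def Enc {SL SH : Type*} (X : Set SH)
    (P : Set (SL × SH × (SH → SH → Prop))) : Set SL :=
  {σL | ∃ σH RH, (σL, σH, RH) ∈ P ∧ σH ∈ wlp RH X}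

theorem encoding_relational_triples {SL SH : Type*} (RL : SL → SL → Prop)
    (P Q : Set (SL × SH × (SH → SH → Prop))) :
    RelTriple P RL Q ↔ ∀ X : Set SH, HoareForall (Enc X P) RL (Enc X Q) := by
  constructor
  · rintro h X σL₁ ⟨σH₁, R₁, hP, hX⟩ σL₂ hR
    obtain ⟨σH₂, R₂, href, hQ⟩ := h σL₁ σH₁ R₁ hP σL₂ hR
    exact ⟨σH₂, R₂, hQ, fun σ hσ => hX σ (href σ hσ)⟩
  · intro h σL₁ σH₁ R₁ hP σL₂ hR
    obtain ⟨σH₂, R₂, hQ, hX⟩ :=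
      h {σ | R₁ σH₁ σ} σL₁ ⟨σH₁, R₁, hP, fun _ hσ => hσ⟩ σL₂ hR
    exact ⟨σH₂, R₂, hX, hQ⟩
end

section
/- (Encoded High-Focus rule) Let P₁, P₂ ⊆ ΣH and R₁, R₂ be relations on ΣH. If the angelic Hoare triple ⊢∃ {P₁} R₁ {P₂} is valid, then for every X ⊆ ΣH, Exec_X(P₁, R₁ ; R₂) implies Exec_X(P₂, R₂). -/
/-- The execution predicate `Exec_X(P, RH)`. -/
def Exec {SH : Type*} (X : Set SH) (P : Set SH) (RH : SH → SH → Prop) : Prop :=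
  ∃ σH ∈ P, σH ∈ wlp RH X

/-- Sequential composition of relations. -/
def seqRel {S : Type*} (R₁ R₂ : S → S → Prop) : S → S → Prop :=
  fun σ σ'' => ∃ σ', R₁ σ σ' ∧ R₂ σ' σ''

/-- Validity of the angelic Hoare triple `⊢∃ {P} R {Q}`. -/
def HoareExists {S : Type*} (P : Set S) (R : S → S → Prop) (Q : Set S) : Prop :=
  ∀ σ ∈ P, ∃ σ', R σ σ' ∧ σ' ∈ Q

theorem encoded_high_focus {SH : Type*} (P₁ P₂ : Set SH)
    (R₁ R₂ : SH → SH → Prop) (h : HoareExists P₁ R₁ P₂) :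
    ∀ X : Set SH, Exec X P₁ (seqRel R₁ R₂) → Exec X P₂ R₂ := by
  rintro X ⟨σ, hσ, hX⟩
  obtain ⟨σ', hR, hσ'⟩ := h σ hσ
  exact ⟨σ', hσ', fun σ'' hR' => hX σ'' ⟨σ', hR, hR'⟩⟩
end

section
/- (Exec-Seq rule) Let P, Q ⊆ ΣH and R₁, R₂ be relations on ΣH. If for every X ⊆ ΣH, Exec_X(P, R₁) implies Exec_X(Q, skip), then for every X ⊆ ΣH, Exec_X(P, R₁ ; R₂) implies Exec_X(Q, R₂). -/
/-- The program `skip`, identified with the identity relation. -/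
def skipRel {S : Type*} : S → S → Prop := fun σ σ' => σ = σ'

theorem exec_seq {SH : Type*} (P Q : Set SH) (R₁ R₂ : SH → SH → Prop)
    (h : ∀ X : Set SH, Exec X P R₁ → Exec X Q skipRel) :
    ∀ X : Set SH, Exec X P (seqRel R₁ R₂) → Exec X Q R₂ := by
  rintro X ⟨σ, hσ, hX⟩
  obtain ⟨τ, hτ, hskip⟩ := h (wlp R₂ X) ⟨σ, hσ, fun σ' h₁ σ'' h₂ => hX σ'' ⟨σ', h₁, h₂⟩⟩
  exact ⟨τ, hτ, hskip τ rfl⟩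
end

section
/- (Encoded vertical composition of refinements, VC-Refine) Let Σ₁, Σ₂, Σ₃ be types, ℙ₁, ℚ₁ ⊆ Σ₁ × Σ₂, ℙ₂, ℚ₂ ⊆ Σ₂ × Σ₃, and let C₁, C₂, C₃ be relations on Σ₁, Σ₂, Σ₃ respectively. Suppose (i) for every X₁ ⊆ Σ₂, the standard triple ⊢∀ {σ₁ | ∃ σ₂, (σ₁, σ₂) ∈ ℙ₁ ∧ σ₂ ∈ wlp(C₂, X₁)} C₁ {σ₁ | ∃ σ₂, (σ₁, σ₂) ∈ ℚ₁ ∧ σ₂ ∈ X₁} is valid, and (ii) for every X₂ ⊆ Σ₃, the standard triple ⊢∀ {σ₂ | ∃ σ₃, (σ₂, σ₃) ∈ ℙ₂ ∧ σ₃ ∈ wlp(C₃, X₂)} C₂ {σ₂ | ∃ σ₃, (σ₂, σ₃) ∈ ℚ₂ ∧ σ₃ ∈ X₂} is valid. Then for every X ⊆ Σ₃, the standard triple ⊢∀ {σ₁ | ∃ σ₃, (σ₁, σ₃) ∈ ℙ₁ ∘ ℙ₂ ∧ σ₃ ∈ wlp(C₃, X)} C₁ {σ₁ | ∃ σ₃,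 (σ₁, σ₃) ∈ ℚ₁ ∘ ℚ₂ ∧ σ₃ ∈ X} is valid. -/
/-- Linking of two binary assertions: `ℙ₁ ∘ ℙ₂`. -/
def linkComp {S1 S2 S3 : Type*} (P₁ : Set (S1 × S2)) (P₂ : Set (S2 × S3)) :
    Set (S1 × S3) :=
  {p | ∃ σ₂, (p.1, σ₂) ∈ P₁ ∧ (σ₂, p.2) ∈ P₂}

theorem vc_refine {S1 S2 S3 : Type*}
    (P₁ Q₁ : Set (S1 × S2)) (P₂ Q₂ : Set (S2 × S3))
    (C₁ : S1 → S1 → Prop) (C₂ : S2 → S2 → Prop) (C₃ : S3 → S3 → Prop)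
    (h₁ : ∀ X₁ : Set S2,
      HoareForall {σ₁ | ∃ σ₂, (σ₁, σ₂) ∈ P₁ ∧ σ₂ ∈ wlp C₂ X₁} C₁
        {σ₁ | ∃ σ₂, (σ₁, σ₂) ∈ Q₁ ∧ σ₂ ∈ X₁})
    (h₂ : ∀ X₂ : Set S3,
      HoareForall {σ₂ | ∃ σ₃, (σ₂, σ₃) ∈ P₂ ∧ σ₃ ∈ wlp C₃ X₂} C₂
        {σ₂ | ∃ σ₃, (σ₂, σ₃) ∈ Q₂ ∧ σ₃ ∈ X₂}) :
    ∀ X : Set S3,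
      HoareForall {σ₁ | ∃ σ₃, (σ₁, σ₃) ∈ linkComp P₁ P₂ ∧ σ₃ ∈ wlp C₃ X} C₁
        {σ₁ | ∃ σ₃, (σ₁, σ₃) ∈ linkComp Q₁ Q₂ ∧ σ₃ ∈ X} := by
  rintro X σ₁ ⟨σ₃, ⟨σ₂, hP₁, hP₂⟩, hX⟩ τ₁ hC
  obtain ⟨τ₂, hQ₁, τ₃, hQ₂, hτ⟩ := h₁ {σ | ∃ σ₃, (σ, σ₃) ∈ Q₂ ∧ σ₃ ∈ X} σ₁
    ⟨σ₂, hP₁, h₂ X σ₂ ⟨σ₃, hP₂, hX⟩⟩ τ₁ hC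
  exact ⟨τ₃, ⟨τ₂, hQ₁, hQ₂⟩, hτ⟩
end

section
/- (Vertical composition with store specifications) Let U, V be types, storePreL : U → Set ΣL, storePreH : U → Set ΣH, storePostL : V → Set ΣL, storePostH : V → Set ΣH, B₁ : U → Prop, B₂ : V → Prop, RL a relation on ΣL, and RH a relation on ΣH. Suppose: (i) for every X ⊆ ΣH, the standard triple ⊢∀ {σL | ∃ u, Exec_X(storePreH u, RH) ∧ σL ∈ storePreL u} RL {σL | ∃ v, Exec_X(storePostH v, skip) ∧ σL ∈ storePostL v} is valid; (ii) the standard triple ⊢∀ {σH | ∃ u, B₁ u ∧ σH ∈ storePreH u} RH {σH | ∀ v, σH ∈ storePostH v → B₂ v} is valid; and (iii) for every u, B₁ u implies that storePreH u is nonempty. Then the standard triple ⊢∀ {σL | ∃ u, B₁ u ∧ σL ∈ storePreL u} RL {σL | ∃ v, B₂ v ∧ σL ∈ storePostL v} is valid. -/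
theorem vc_store {SL SH : Type*} {U V : Type*}
    (storePreL : U → Set SL) (storePreH : U → Set SH)
    (storePostL : V → Set SL) (storePostH : V → Set SH)
    (B₁ : U → Prop) (B₂ : V → Prop)
    (RL : SL → SL → Prop) (RH : SH → SH → Prop)
    (h₁ : ∀ X : Set SH,
      HoareForall {σL | ∃ u, Exec X (storePreH u) RH ∧ σL ∈ storePreL u} RL
        {σL | ∃ v, Exec X (storePostH v) skipRel ∧ σL ∈ storePostL v})
    (h₂ : HoareForall {σH | ∃ u, B₁ u ∧ σH ∈ storePreH u} RH
        {σH | ∀ v, σH ∈ storePostH v → B₂ v})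
    (h₃ : ∀ u, B₁ u → (storePreH u).Nonempty) :
    HoareForall {σL | ∃ u, B₁ u ∧ σL ∈ storePreL u} RL
      {σL | ∃ v, B₂ v ∧ σL ∈ storePostL v} := by
  rintro σL ⟨u, hu, hσL⟩ σL' hR
  obtain ⟨σH, hσH⟩ := h₃ u hu
  obtain ⟨v, ⟨τ, hτ, hτX⟩, hv⟩ :=
    h₁ {σ | ∀ v, σ ∈ storePostH v → B₂ v} σL
      ⟨u, ⟨σH, hσH, h₂ σH ⟨u, hu, hσH⟩⟩, hσL⟩ σL' hR
  exact ⟨v, hτX τ rfl v hτ, hv⟩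
end

section
/- (Encoding relational proof contexts) Let F be a type of function names, χ : F → (ΣL → ΣL → Prop) an environment assigning each function name a low-level denotation, and Γ a relational proof context consisting of, for each f ∈ F, a parameter type A f and families 𝒫 f, 𝒬 f : A f → (program-as-resource assertions). Then χ is relationally valid with respect to Γ (i.e., for every f and every a ∈ A f, the relational Hoare triple ⟨𝒫 f a⟩ (χ f) ⟨𝒬 f a⟩ is valid) if and only if χ is valid with respect to the encoded context (i.e., for every f, every X ⊆ ΣH, and every a ∈ A f, the standard Hoare triple ⊢∀ {⦇𝒫 f a⦈_X} (χ f) {⦇𝒬 f a⦈_X} is valid). -/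
/-- A relational triple is valid iff all its encodings are valid standard triples. -/
theorem relTriple_iff_forall_hoareForall_enc {SL SH : Type*}
    (P Q : Set (SL × SH × (SH → SH → Prop))) (R : SL → SL → Prop) :
    RelTriple P R Q ↔ ∀ X : Set SH, HoareForall (Enc X P) R (Enc X Q) := by
  constructor
  · rintro h X σL₁ ⟨σH₁, R₁, hP, hX⟩ σL₂ hR
    obtain ⟨σH₂, R₂, href, hQ⟩ := h σL₁ σH₁ R₁ hP σL₂ hR
    exact ⟨σH₂, R₂, hQ, fun σ₃ h₃ => hX σ₃ (href σ₃ h₃)⟩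
  · intro h σL₁ σH₁ R₁ hP σL₂ hR
    obtain ⟨σH₂, R₂, hQ, hwlp⟩ :=
      h {σ | R₁ σH₁ σ} σL₁ ⟨σH₁, R₁, hP, fun _ h₁ => h₁⟩ σL₂ hR
    exact ⟨σH₂, R₂, hwlp, hQ⟩

theorem encoding_rel_context {SL SH : Type*} {F : Type*}
    (χ : F → (SL → SL → Prop))
    (A : F → Type*)
    (P Q : (f : F) → A f → Set (SL × SH × (SH → SH → Prop))) :
    (∀ f : F, ∀ a : A f, RelTriple (P f a) (χ f) (Q f a)) ↔
      (∀ f : F, ∀ X : Set SH, ∀ a : A f,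
        HoareForall (Enc X (P f a)) (χ f) (Enc X (Q f a))) := by
  simp only [relTriple_iff_forall_hoareForall_enc]
  exact forall_congr' fun _ => forall_comm
end

section
/- (Encoding relational triples with errors) For every low-level program cL (a pair of a normal-termination relation and an error set on ΣL) and all error-aware program-as-resource assertions 𝒫, 𝒬: the error-aware relational Hoare triple ⟨𝒫⟩ cL ⟨𝒬⟩ is valid if and only if for every X ⊆ ΣH the error-aware standard Hoare triple ⊢∀ {⦇𝒫⦈_X} cL {⦇𝒬⦈_X} is valid. -/
/-- A program with possible runtime errors: a normal-termination relation
and a set of erroneous initial states. -/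
structure ProgErr (S : Type*) where
  nrm : S → S → Prop
  err : Set S

/-- Error-aware weakest precondition `wp(c, X)`. -/
def wp {S : Type*} (c : ProgErr S) (X : Set S) : Set S :=
  {σ | σ ∉ c.err ∧ ∀ σ', c.nrm σ σ' → σ' ∈ X}

/-- Error-aware configuration refinement `(σ₁, c₁) ↪ (σ₂, c₂)`. -/
def ConfigRefinesErr {S : Type*} (σ₁ : S) (c₁ : ProgErr S)
    (σ₂ : S) (c₂ : ProgErr S) : Prop :=
  (∀ σ₃, c₂.nrm σ₂ σ₃ → c₁.nrm σ₁ σ₃) ∧ (σ₂ ∈ c₂.err → σ₁ ∈ c₁.err)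

/-- Validity of the error-aware standard Hoare triple `⊢∀ {P} c {Q}`. -/
def HoareForallErr {S : Type*} (P : Set S) (c : ProgErr S) (Q : Set S) : Prop :=
  ∀ σ₁ ∈ P, σ₁ ∉ c.err ∧ ∀ σ₂, c.nrm σ₁ σ₂ → σ₂ ∈ Q

/-- Validity of the error-aware relational Hoare triple `⟨𝒫⟩ cL ⟨𝒬⟩`. -/
def RelTripleErr {SL SH : Type*}
    (P : Set (SL × SH × ProgErr SH)) (cL : ProgErr SL)
    (Q : Set (SL × SH × ProgErr SH)) : Prop :=
  ∀ σL₁ σH₁ c₁, (σL₁, σH₁, c₁) ∈ P →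
    (σL₁ ∈ cL.err → σH₁ ∈ c₁.err) ∧
    (∀ σL₂, cL.nrm σL₁ σL₂ →
      σH₁ ∈ c₁.err ∨
        ∃ σH₂ c₂, ConfigRefinesErr σH₁ c₁ σH₂ c₂ ∧ (σL₂, σH₂, c₂) ∈ Q)

/-- The error-aware encoding `⦇𝒫⦈_X`. -/
def EncErr {SL SH : Type*} (X : Set SH)
    (P : Set (SL × SH × ProgErr SH)) : Set SL :=
  {σL | ∃ σH cH, (σL, σH, cH) ∈ P ∧ σH ∈ wp cH X}

theorem encoding_relational_triples_err {SL SH : Type*}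
    (cL : ProgErr SL) (P Q : Set (SL × SH × ProgErr SH)) :
    RelTripleErr P cL Q ↔
      ∀ X : Set SH, HoareForallErr (EncErr X P) cL (EncErr X Q) := by
  constructor
  · rintro h X σL ⟨σH, cH, hP, hne, hX⟩
    obtain ⟨herr, hres⟩ := h σL σH cH hP
    refine ⟨fun he => hne (herr he), fun σL₂ hn => ?_⟩
    obtain he | ⟨σH₂, c₂, ⟨hsub, hsafe⟩, hQ⟩ := hres σL₂ hn
    · exact absurd he hne
    · exact ⟨σH₂, c₂, hQ, fun he => hne (hsafe he), fun σ' hσ' => hX σ' (hsub σ' hσ')⟩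
  · intro h σL₁ σH₁ c₁ hP
    by_cases hne : σH₁ ∈ c₁.err
    · exact ⟨fun _ => hne, fun _ _ => Or.inl hne⟩
    · obtain ⟨herr, hres⟩ := h {σ | c₁.nrm σH₁ σ} σL₁ ⟨σH₁, c₁, hP, hne, fun _ hσ => hσ⟩
      refine ⟨fun he => absurd he herr, fun σL₂ hn => Or.inr ?_⟩
      obtain ⟨σH₂, c₂, hQ, hne₂, hX⟩ := hres σL₂ hn
      exact ⟨σH₂, c₂, ⟨hX, fun he => absurd he hne₂⟩, hQ⟩
end
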